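/- For every real number μ, the complex dimension of the subspace {f ∈ E_μ : f∘τ = f} equals the complex dimension of the subspace {f ∈ E_μ : f∘ρ_x = f and f∘ρ_y = f}. (These are, respectively, the eigenspaces of the Laplacian with eigenvalue 4π²μ on the tetracosm Tetra and on the didicosm Didi, so this equality expresses that Tetra and Didi are isospectral.) -/

import Mathlib

noncomputable section

open Real

/-- Points of `ℝ³`, written as `(x, y, z)`. -/
abbrev R3 : Type := ℝ × ℝ × ℝ

/-- The space of functions `ℝ³ → ℂ`. -/
abbrev FunSp : Type := R3 → ℂ

/-- `φ_{(a,b,c)}(x,y,z) = exp(2πi(ax+by+cz))`. -/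
noncomputable def phi (a b c : ℝ) : FunSp :=
  fun p => Complex.exp (2 * (Real.pi : ℂ) * Complex.I *
    ((a : ℂ) * (p.1 : ℂ) + (b : ℂ) * (p.2.1 : ℂ) + (c : ℂ) * (p.2.2 : ℂ)))

/-- `τ(x,y,z) = (−y, x, z+1/2)`. -/
def tauMap : R3 → R3 := fun p => (-p.2.1, p.1, p.2.2 + 1/2)

/-- `ρ_x(x,y,z) = (x+1/2, −y, −z)`. -/
def rhoxMap : R3 → R3 := fun p => (p.1 + 1/2, -p.2.1, -p.2.2)

/-- `ρ_y(x,y,z) = (−x, y+1/2, 1−z)`. -/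
def rhoyMap : R3 → R3 := fun p => (-p.1, p.2.1 + 1/2, 1 - p.2.2)

/-- `ρ_z(x,y,z) = (1/2−x, 1/2−y, z+1)`. -/
def rhozMap : R3 → R3 := fun p => (1/2 - p.1, 1/2 - p.2.1, p.2.2 + 1)

/-- The Tetra symmetrization `σ^T f = (1/4)(f + f∘τ + f∘τ∘τ + f∘τ∘τ∘τ)`. -/
noncomputable def sigmaT : FunSp →ₗ[ℂ] FunSp :=
  (4⁻¹ : ℂ) • (LinearMap.id + LinearMap.funLeft ℂ ℂ tauMap
    + LinearMap.funLeft ℂ ℂ (tauMap ∘ tauMap)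
    + LinearMap.funLeft ℂ ℂ (tauMap ∘ tauMap ∘ tauMap))

/-- The Didi symmetrization `σ^D f = (1/4)(f + f∘ρ_x + f∘ρ_y + f∘ρ_z)`. -/
noncomputable def sigmaD : FunSp →ₗ[ℂ] FunSp :=
  (4⁻¹ : ℂ) • (LinearMap.id + LinearMap.funLeft ℂ ℂ rhoxMap
    + LinearMap.funLeft ℂ ℂ rhoyMap + LinearMap.funLeft ℂ ℂ rhozMap)

/-- `V_{a,b,c}`: the ℂ-span of the 16 functions `φ_{(±a,±b,±c)}`, `φ_{(±b,±a,±c)}`. -/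
def Vspace (a b c : ℝ) : Submodule ℂ FunSp :=
  Submodule.span ℂ {f | ∃ s₁ s₂ s₃ : ℝ,
    s₁ ∈ ({1, -1} : Set ℝ) ∧ s₂ ∈ ({1, -1} : Set ℝ) ∧ s₃ ∈ ({1, -1} : Set ℝ) ∧
    (f = phi (s₁ * a) (s₂ * b) (s₃ * c) ∨ f = phi (s₁ * b) (s₂ * a) (s₃ * c))}

end

/-- `E_μ`: the ℂ-span of the `φ_{(a,b,c)}` with `(a,b,c) ∈ ℤ × ℤ × (1/2)ℤ` and
`a² + b² + c² = μ`. -/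
noncomputable def Espace (μ : ℝ) : Submodule ℂ FunSp :=
  Submodule.span ℂ {f | ∃ a b c : ℝ, (∃ m : ℤ, a = (m : ℝ)) ∧ (∃ m : ℤ, b = (m : ℝ)) ∧
    (∃ m : ℤ, c = (m : ℝ) / 2) ∧ a ^ 2 + b ^ 2 + c ^ 2 = μ ∧ f = phi a b c}

/-- The subspace of functions invariant under `τ` (i.e. `f ∘ τ = f`). -/
noncomputable def fixT : Submodule ℂ FunSp :=
  LinearMap.eqLocus (LinearMap.funLeft ℂ ℂ tauMap) LinearMap.id

/-- The subspace of functions invariant under `ρ_x`. -/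
noncomputable def fixX : Submodule ℂ FunSp :=
  LinearMap.eqLocus (LinearMap.funLeft ℂ ℂ rhoxMap) LinearMap.id

/-- The subspace of functions invariant under `ρ_y`. -/
noncomputable def fixY : Submodule ℂ FunSp :=
  LinearMap.eqLocus (LinearMap.funLeft ℂ ℂ rhoyMap) LinearMap.id

/-- index set -/
abbrev IdxS (μ : ℝ) : Type :=
  {v : ℤ × ℤ × ℤ // (v.1 : ℝ) ^ 2 + (v.2.1 : ℝ) ^ 2 + ((v.2.2 : ℝ) / 2) ^ 2 = μ}

instance idxFinite (μ : ℝ) : Finite (IdxS μ) := by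
  obtain ⟨B, hB⟩ := exists_nat_ge (4 * μ + 1)
  have hfin : (Set.Icc (-(B : ℤ)) B ×ˢ (Set.Icc (-(B : ℤ)) B ×ˢ Set.Icc (-(B : ℤ)) B)).Finite :=
    (Set.finite_Icc _ _).prod ((Set.finite_Icc _ _).prod (Set.finite_Icc _ _))
  refine (hfin.subset ?_).to_subtype
  rintro ⟨m, n, k⟩ h
  change (m : ℝ) ^ 2 + (n : ℝ) ^ 2 + ((k : ℝ) / 2) ^ 2 = μ at h
  have key : ∀ j : ℤ, (j : ℝ) ^ 2 ≤ 4 * μ → j ∈ Set.Icc (-(B : ℤ)) B := by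
    intro j hj
    have h1 : (j : ℝ) ^ 2 ≤ B := by linarith
    have h2 : j ^ 2 ≤ (B : ℤ) := by exact_mod_cast h1
    constructor <;> nlinarith
  refine ⟨key m ?_, key n ?_, key k ?_⟩ <;>
    nlinarith [sq_nonneg (m : ℝ), sq_nonneg (n : ℝ), sq_nonneg (k : ℝ)]

noncomputable instance idxFintype (μ : ℝ) : Fintype (IdxS μ) := Fintype.ofFinite _

/-- `phi` as a character -/
noncomputable def phiHom (a b c : ℝ) : Multiplicative R3 →* ℂ where
  toFun p := phi a b c p.toAdd
  map_one' := by simp [phi]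
  map_mul' p q := by
    simp only [phi, toAdd_mul, Prod.fst_add, Prod.snd_add, Complex.ofReal_add, ← Complex.exp_add]
    congr 1
    ring

lemma exp_lin_inj {a a' : ℝ} (h : ∀ x : ℝ, Complex.exp (2 * (Real.pi : ℂ) * Complex.I * (a * x)) =
    Complex.exp (2 * (Real.pi : ℂ) * Complex.I * (a' * x))) : a = a' := by
  by_contra hne
  have hd : ((a : ℂ) - a') ≠ 0 := by
    rw [sub_ne_zero]; exact_mod_cast hne
  have h1 := h (1 / (2 * (a - a')))
  have h2 : Complex.exp (2 * (Real.pi : ℂ) * Complex.I * (a * (1 / (2 * (a - a')) : ℝ)) -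
      2 * (Real.pi : ℂ) * Complex.I * (a' * (1 / (2 * (a - a')) : ℝ))) = 1 := by
    rw [Complex.exp_sub, h1, div_self (Complex.exp_ne_zero _)]
  have h3 : (2 * (Real.pi : ℂ) * Complex.I * (a * (1 / (2 * (a - a')) : ℝ)) -
      2 * (Real.pi : ℂ) * Complex.I * (a' * (1 / (2 * (a - a')) : ℝ))) = Real.pi * Complex.I := by
    push_cast
    field_simp
  rw [h3, Complex.exp_pi_mul_I] at h2
  norm_num at h2

lemma phi_inj {a b c a' b' c' : ℝ} (h : phi a b c = phi a' b' c') :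
    a = a' ∧ b = b' ∧ c = c' := by
  refine ⟨exp_lin_inj fun x => ?_, exp_lin_inj fun x => ?_, exp_lin_inj fun x => ?_⟩
  · simpa [phi] using congrFun h (x, 0, 0)
  · simpa [phi] using congrFun h (0, x, 0)
  · simpa [phi] using congrFun h (0, 0, x)

/-- the basis functions -/
noncomputable def ph (v : ℤ × ℤ × ℤ) : FunSp := phi v.1 v.2.1 (v.2.2 / 2)

lemma ph_linInd (μ : ℝ) : LinearIndependent ℂ (fun v : IdxS μ => ph v.1) := by
  have h := linearIndependent_monoidHom (Multiplicative R3) ℂ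
  have h2 := h.comp (fun v : IdxS μ => phiHom v.1.1 v.1.2.1 (v.1.2.2 / 2)) (by
    rintro ⟨⟨m, n, k⟩, h1⟩ ⟨⟨m', n', k'⟩, h2⟩ h
    have h3 : phi m n (k / 2) = phi m' n' (k' / 2) := by
      funext p
      exact DFunLike.congr_fun h (Multiplicative.ofAdd p)
    obtain ⟨e1, e2, e3⟩ := phi_inj h3
    have e4 : (k : ℝ) = k' := by linarith
    have e1' : m = m' := by exact_mod_cast e1
    have e2' : n = n' := by exact_mod_cast e2
    have e4' : k = k' := by exact_mod_cast e4
    subst e1' e2' e4'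
    rfl)
  exact h2

/-- synthesis map -/
noncomputable def Syn (μ : ℝ) : (IdxS μ → ℂ) →ₗ[ℂ] FunSp :=
  Fintype.linearCombination ℂ (fun v : IdxS μ => ph v.1)

lemma Syn_inj (μ : ℝ) : Function.Injective (Syn μ) :=
  (linearIndependent_iff_injective_fintypeLinearCombination).1 (ph_linInd μ)

lemma Syn_range (μ : ℝ) : LinearMap.range (Syn μ) = Espace μ := by
  rw [Syn, Fintype.range_linearCombination, Espace]
  congr 1
  ext f
  constructor
  · rintro ⟨v, rfl⟩
    exact ⟨_, _, _, ⟨_, rfl⟩, ⟨_, rfl⟩, ⟨_, rfl⟩, v.2, rfl⟩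
  · rintro ⟨a, b, c, ⟨m, rfl⟩, ⟨n, rfl⟩, ⟨k, rfl⟩, h, rfl⟩
    exact ⟨⟨(m, n, k), h⟩, rfl⟩

/-- monomial operator -/
def mono {S : Type} (e : S ≃ S) (χ : S → ℂ) : (S → ℂ) →ₗ[ℂ] (S → ℂ) where
  toFun c t := χ (e t) * c (e t)
  map_add' c d := by ext t; simp [mul_add]
  map_smul' r c := by ext t; simp; ring

lemma mono_apply {S : Type} (e : S ≃ S) (χ : S → ℂ) (c : S → ℂ) (t : S) :
    mono e χ c t = χ (e t) * c (e t) := rfl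

lemma mono_trace {S : Type} [Fintype S] [DecidableEq S] (e : S ≃ S) (χ : S → ℂ) :
    LinearMap.trace ℂ _ (mono e χ) = ∑ t, if e t = t then χ t else 0 := by
  rw [LinearMap.trace_eq_matrix_trace ℂ (Pi.basisFun ℂ S), Matrix.trace]
  refine Finset.sum_congr rfl fun t _ => ?_
  simp only [Matrix.diag_apply, LinearMap.toMatrix_apply, Pi.basisFun_apply, Pi.basisFun_repr,
    mono_apply, Pi.single_apply]
  split_ifs with h <;> simp [h]

lemma Syn_mono (μ : ℝ) (e : IdxS μ ≃ IdxS μ) (χ : IdxS μ → ℂ) (g : R3 → R3)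
    (h : ∀ t : IdxS μ, LinearMap.funLeft ℂ ℂ g (ph (e t).1) = χ (e t) • ph t.1) (c : IdxS μ → ℂ) :
    Syn μ (mono e χ c) = LinearMap.funLeft ℂ ℂ g (Syn μ c) := by
  simp only [Syn, Fintype.linearCombination_apply, map_sum, map_smul, mono_apply]
  rw [← Equiv.sum_comp e (fun t => c t • LinearMap.funLeft ℂ ℂ g (ph t.1))]
  refine Finset.sum_congr rfl fun t _ => ?_
  rw [h, smul_smul, mul_comm]

/-- rotation -/
def eT (μ : ℝ) : IdxS μ ≃ IdxS μ where
  toFun t := ⟨(-t.1.2.1, t.1.1, t.1.2.2), by refine Eq.trans ?_ t.2; push_cast; ring⟩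
  invFun t := ⟨(t.1.2.1, -t.1.1, t.1.2.2), by refine Eq.trans ?_ t.2; push_cast; ring⟩
  left_inv t := by simp
  right_inv t := by simp

def eX (μ : ℝ) : IdxS μ ≃ IdxS μ where
  toFun t := ⟨(t.1.1, -t.1.2.1, -t.1.2.2), by refine Eq.trans ?_ t.2; push_cast; ring⟩
  invFun t := ⟨(t.1.1, -t.1.2.1, -t.1.2.2), by refine Eq.trans ?_ t.2; push_cast; ring⟩
  left_inv t := by simp
  right_inv t := by simp

def eY (μ : ℝ) : IdxS μ ≃ IdxS μ where
  toFun t := ⟨(-t.1.1, t.1.2.1, -t.1.2.2), by refine Eq.trans ?_ t.2; push_cast; ring⟩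
  invFun t := ⟨(-t.1.1, t.1.2.1, -t.1.2.2), by refine Eq.trans ?_ t.2; push_cast; ring⟩
  left_inv t := by simp
  right_inv t := by simp

def eZ (μ : ℝ) : IdxS μ ≃ IdxS μ where
  toFun t := ⟨(-t.1.1, -t.1.2.1, t.1.2.2), by refine Eq.trans ?_ t.2; push_cast; ring⟩
  invFun t := ⟨(-t.1.1, -t.1.2.1, t.1.2.2), by refine Eq.trans ?_ t.2; push_cast; ring⟩
  left_inv t := by simp
  right_inv t := by simp

noncomputable def xT (μ : ℝ) (t : IdxS μ) : ℂ := Complex.I ^ t.1.2.2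
noncomputable def xX (μ : ℝ) (t : IdxS μ) : ℂ := (-1) ^ t.1.1
noncomputable def xY (μ : ℝ) (t : IdxS μ) : ℂ := (-1) ^ t.1.2.1 * (-1) ^ t.1.2.2
noncomputable def xZ (μ : ℝ) (t : IdxS μ) : ℂ := (-1) ^ t.1.1 * ((-1) ^ t.1.2.1 * (-1) ^ t.1.2.2)

noncomputable def oT (μ : ℝ) := mono (eT μ) (xT μ)
noncomputable def oX (μ : ℝ) := mono (eX μ) (xX μ)
noncomputable def oY (μ : ℝ) := mono (eY μ) (xY μ)
noncomputable def oZ (μ : ℝ) := mono (eZ μ) (xZ μ)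
noncomputable def oT2 (μ : ℝ) := mono (eZ μ) (fun t => (-1 : ℂ) ^ t.1.2.2)
noncomputable def oT3 (μ : ℝ) := mono (eT μ).symm (fun t => (-Complex.I) ^ t.1.2.2)

lemma I_zpow (k : ℤ) : Complex.I ^ k = Complex.exp (Real.pi * Complex.I * (k / 2)) := by
  have : Real.pi * Complex.I * ((k : ℂ) / 2) = k * (Real.pi / 2 * Complex.I) := by ring
  rw [this, Complex.exp_int_mul, Complex.exp_pi_div_two_mul_I]

lemma neg_one_zpow_exp (k : ℤ) : (-1 : ℂ) ^ k = Complex.exp (Real.pi * Complex.I * k) := by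
  rw [mul_comm, Complex.exp_int_mul, Complex.exp_pi_mul_I]

lemma neg_one_zpow_exp_neg (k : ℤ) : (-1 : ℂ) ^ k = Complex.exp (-(Real.pi * Complex.I * k)) := by
  rw [Complex.exp_neg, ← neg_one_zpow_exp, ← inv_zpow]; norm_num

lemma synT (μ : ℝ) (c : IdxS μ → ℂ) :
    Syn μ (oT μ c) = LinearMap.funLeft ℂ ℂ tauMap (Syn μ c) := by
  refine Syn_mono μ _ _ _ (fun t => ?_) c
  funext p
  simp only [LinearMap.funLeft_apply, ph, phi, eT, xT, tauMap, Equiv.coe_fn_mk, Pi.smul_apply,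
    smul_eq_mul, I_zpow, ← Complex.exp_add]
  congr 1
  push_cast
  ring

lemma synX (μ : ℝ) (c : IdxS μ → ℂ) :
    Syn μ (oX μ c) = LinearMap.funLeft ℂ ℂ rhoxMap (Syn μ c) := by
  refine Syn_mono μ _ _ _ (fun t => ?_) c
  funext p
  simp only [LinearMap.funLeft_apply, ph, phi, eX, xX, rhoxMap, Equiv.coe_fn_mk, Pi.smul_apply,
    smul_eq_mul, neg_one_zpow_exp, ← Complex.exp_add]
  congr 1
  push_cast
  ring

lemma synY (μ : ℝ) (c : IdxS μ → ℂ) :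
    Syn μ (oY μ c) = LinearMap.funLeft ℂ ℂ rhoyMap (Syn μ c) := by
  refine Syn_mono μ _ _ _ (fun t => ?_) c
  funext p
  simp only [LinearMap.funLeft_apply, ph, phi, eY, xY, rhoyMap, Equiv.coe_fn_mk, Pi.smul_apply,
    smul_eq_mul, neg_one_zpow_exp, ← Complex.exp_add]
  congr 1
  push_cast
  ring

lemma nn (k : ℤ) : (-1 : ℂ) ^ k * (-1 : ℂ) ^ k = 1 := by
  rw [← mul_zpow]; norm_num

lemma II (k : ℤ) : Complex.I ^ k * Complex.I ^ k = (-1 : ℂ) ^ k := by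
  rw [← mul_zpow]; norm_num

lemma oT_sq (μ : ℝ) (c : IdxS μ → ℂ) : oT μ (oT μ c) = oT2 μ c := by
  funext t
  simp only [oT, oT2, mono_apply, eT, eZ, xT, Equiv.coe_fn_mk, ← mul_assoc, II]

lemma oT_cube (μ : ℝ) (c : IdxS μ → ℂ) : oT μ (oT2 μ c) = oT3 μ c := by
  funext t
  simp only [oT, oT2, oT3, mono_apply, eT, eZ, xT, Equiv.coe_fn_mk, Equiv.coe_fn_symm_mk,
    ← mul_assoc, ← mul_zpow, neg_neg, mul_neg, mul_one]

lemma oT_four (μ : ℝ) (c : IdxS μ → ℂ) : oT μ (oT3 μ c) = c := by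
  funext t
  simp [oT, oT3, mono_apply, eT, xT, ← mul_assoc, ← mul_zpow]

lemma oX_sq (μ : ℝ) (c : IdxS μ → ℂ) : oX μ (oX μ c) = c := by
  funext t
  simp [oX, mono_apply, eX, xX, ← mul_assoc, nn]

lemma oY_sq (μ : ℝ) (c : IdxS μ → ℂ) : oY μ (oY μ c) = c := by
  funext t
  simp only [oY, mono_apply, eY, xY, Equiv.coe_fn_mk, neg_neg, ← mul_assoc, zpow_neg, ← inv_zpow]
  norm_num
  linear_combination (nn t.1.2.1 * (-1 : ℂ) ^ t.1.2.2 * (-1 : ℂ) ^ t.1.2.2 + nn t.1.2.2) * c t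

lemma oXY (μ : ℝ) (c : IdxS μ → ℂ) : oX μ (oY μ c) = oZ μ c := by
  funext t
  simp only [oX, oY, oZ, mono_apply, eX, eY, eZ, xX, xY, xZ, Equiv.coe_fn_mk, neg_neg, zpow_neg,
    ← inv_zpow, ← mul_assoc]
  norm_num

lemma oYX (μ : ℝ) (c : IdxS μ → ℂ) : oY μ (oX μ c) = oZ μ c := by
  funext t
  simp only [oX, oY, oZ, mono_apply, eX, eY, eZ, xX, xY, xZ, Equiv.coe_fn_mk, neg_neg, zpow_neg,
    ← inv_zpow, ← mul_assoc]
  norm_num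
  left
  ring

/-- fixed coefficient spaces -/
noncomputable def FT (μ : ℝ) : Submodule ℂ (IdxS μ → ℂ) := LinearMap.eqLocus (oT μ) LinearMap.id
noncomputable def FD (μ : ℝ) : Submodule ℂ (IdxS μ → ℂ) :=
  LinearMap.eqLocus (oX μ) LinearMap.id ⊓ LinearMap.eqLocus (oY μ) LinearMap.id

lemma mapT (μ : ℝ) : Espace μ ⊓ fixT = (FT μ).map (Syn μ) := by
  rw [← Syn_range]
  ext f
  constructor
  · rintro ⟨⟨c, rfl⟩, h⟩
    refine ⟨c, Syn_inj μ ?_, rfl⟩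
    rw [synT]; exact h
  · rintro ⟨c, h, rfl⟩
    refine ⟨⟨c, rfl⟩, ?_⟩
    have h' : oT μ c = c := h
    change LinearMap.funLeft ℂ ℂ tauMap (Syn μ c) = Syn μ c
    rw [← synT, h']

lemma mapD (μ : ℝ) : Espace μ ⊓ (fixX ⊓ fixY) = (FD μ).map (Syn μ) := by
  rw [← Syn_range]
  ext f
  constructor
  · rintro ⟨⟨c, rfl⟩, h, h2⟩
    refine ⟨c, ⟨Syn_inj μ ?_, Syn_inj μ ?_⟩, rfl⟩
    · rw [synX]; exact h
    · rw [synY]; exact h2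
  · rintro ⟨c, ⟨h, h2⟩, rfl⟩
    have h' : oX μ c = c := h
    have h2' : oY μ c = c := h2
    refine ⟨⟨c, rfl⟩, ?_, ?_⟩
    · change LinearMap.funLeft ℂ ℂ rhoxMap (Syn μ c) = Syn μ c
      rw [← synX, h']
    · change LinearMap.funLeft ℂ ℂ rhoyMap (Syn μ c) = Syn μ c
      rw [← synY, h2']

lemma projT (μ : ℝ) : LinearMap.IsProj (FT μ)
    ((4⁻¹ : ℂ) • (LinearMap.id + oT μ + oT2 μ + oT3 μ)) := by
  constructor
  · intro c
    change oT μ _ = _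
    simp only [LinearMap.smul_apply, LinearMap.add_apply, LinearMap.id_apply, map_smul, map_add,
      oT_sq, oT_cube, oT_four]
    congr 1
    abel
  · intro c h
    have h' : oT μ c = c := h
    have h2 : oT2 μ c = c := by rw [← oT_sq, h', h']
    have h3 : oT3 μ c = c := by rw [← oT_cube, h2, h']
    simp only [LinearMap.smul_apply, LinearMap.add_apply, LinearMap.id_apply, h', h2, h3]
    module

lemma projD (μ : ℝ) : LinearMap.IsProj (FD μ)
    ((4⁻¹ : ℂ) • (LinearMap.id + oX μ + oY μ + oZ μ)) := by
  have hXZ : ∀ c, oX μ (oZ μ c) = oY μ c := fun c => by rw [← oXY, oX_sq]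
  have hYZ : ∀ c, oY μ (oZ μ c) = oX μ c := fun c => by rw [← oYX, oY_sq]
  constructor
  · intro c
    constructor
    · change oX μ _ = _
      simp only [LinearMap.smul_apply, LinearMap.add_apply, LinearMap.id_apply, map_smul, map_add,
        oX_sq, oXY, hXZ]
      congr 1
      abel
    · change oY μ _ = _
      simp only [LinearMap.smul_apply, LinearMap.add_apply, LinearMap.id_apply, map_smul, map_add,
        oY_sq, oYX, hYZ]
      congr 1
      abel
  · rintro c ⟨h, h2⟩
    have h' : oX μ c = c := h
    have h2' : oY μ c = c := h2
    have h3 : oZ μ c = c := by rw [← oXY, h2', h']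
    simp only [LinearMap.smul_apply, LinearMap.add_apply, LinearMap.id_apply, h', h2', h3]
    module

lemma I_even (m : ℤ) : Complex.I ^ (2 * m) + (-Complex.I) ^ (2 * m) = (-1) ^ m + (-1) ^ m := by
  rw [zpow_mul, zpow_mul]
  norm_num [zpow_ofNat]

lemma I_odd (k : ℤ) (h : Odd k) : Complex.I ^ k + (-Complex.I) ^ k = 0 := by
  rw [h.neg_zpow]; ring

open Classical in
lemma axisX (μ : ℝ) (g : ℤ → ℂ) :
    (∑ t : IdxS μ, if t.1.2.1 = 0 ∧ t.1.2.2 = 0 then g t.1.1 else 0) =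
    ∑ t : IdxS μ, if t.1.1 = 0 ∧ t.1.2.1 = 0 ∧ Even t.1.2.2 then g (t.1.2.2 / 2) else 0 := by
  rw [← Finset.sum_filter, ← Finset.sum_filter]
  refine Finset.sum_bij'
    (fun t ht => ⟨(0, 0, 2 * t.1.1), ?_⟩) (fun t ht => ⟨(t.1.2.2 / 2, 0, 0), ?_⟩) ?_ ?_ ?_ ?_ ?_
  · have h := t.2
    simp only [Finset.mem_filter, Finset.mem_univ, true_and] at ht
    rw [ht.1, ht.2] at h
    refine Eq.trans ?_ h; push_cast; ring
  · have h := t.2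
    simp only [Finset.mem_filter, Finset.mem_univ, true_and] at ht
    obtain ⟨h1, h2, j, hj⟩ := ht
    have hj2 : t.1.2.2 / 2 = j := by omega
    rw [h1, h2, hj] at h
    simp only [hj2]
    rw [← h]; push_cast; ring
  · rintro ⟨⟨m, n, k⟩, h⟩ ht
    simp
  · rintro ⟨⟨m, n, k⟩, h⟩ ht
    simp
  · rintro ⟨⟨m, n, k⟩, h⟩ ht
    simp at ht ⊢
    simp [ht]
  · rintro ⟨⟨m, n, k⟩, h⟩ ht
    simp only [Finset.mem_filter, Finset.mem_univ, true_and] at ht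
    obtain ⟨h1, h2, j, hj⟩ := ht
    simp only [Subtype.mk.injEq, Prod.mk.injEq]
    refine ⟨h1.symm, h2.symm, by omega⟩
  · rintro ⟨⟨m, n, k⟩, h⟩ ht
    simp

/-- swap -/
def eS (μ : ℝ) : IdxS μ ≃ IdxS μ where
  toFun t := ⟨(t.1.2.1, t.1.1, t.1.2.2), by refine Eq.trans ?_ t.2; push_cast; ring⟩
  invFun t := ⟨(t.1.2.1, t.1.1, t.1.2.2), by refine Eq.trans ?_ t.2; push_cast; ring⟩
  left_inv t := by simp
  right_inv t := by simp

lemma axisY (μ : ℝ) (g : ℤ → ℂ) :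
    (∑ t : IdxS μ, if t.1.1 = 0 ∧ t.1.2.2 = 0 then g t.1.2.1 else 0) =
    ∑ t : IdxS μ, if t.1.2.1 = 0 ∧ t.1.2.2 = 0 then g t.1.1 else 0 := by
  rw [← Equiv.sum_comp (eS μ)]
  rfl

lemma trT (μ : ℝ) : LinearMap.trace ℂ _ (oT μ) =
    ∑ t : IdxS μ, if t.1.1 = 0 ∧ t.1.2.1 = 0 then Complex.I ^ t.1.2.2 else 0 := by
  rw [oT, mono_trace]
  refine Finset.sum_congr rfl fun t _ => ?_
  obtain ⟨⟨m, n, k⟩, h⟩ := t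
  refine if_congr ?_ rfl rfl
  rw [Subtype.ext_iff]
  simp only [eT, Equiv.coe_fn_mk, Prod.ext_iff, and_true, true_and]
  constructor
  · rintro ⟨h1, h2⟩; constructor <;> omega
  · rintro ⟨h1, h2⟩; constructor <;> omega

lemma trT2 (μ : ℝ) : LinearMap.trace ℂ _ (oT2 μ) =
    ∑ t : IdxS μ, if t.1.1 = 0 ∧ t.1.2.1 = 0 then (-1) ^ t.1.2.2 else 0 := by
  rw [oT2, mono_trace]
  refine Finset.sum_congr rfl fun t _ => ?_
  obtain ⟨⟨m, n, k⟩, h⟩ := t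
  refine if_congr ?_ rfl rfl
  rw [Subtype.ext_iff]
  simp only [eZ, Equiv.coe_fn_mk, Prod.ext_iff, and_true, true_and]
  constructor
  · rintro ⟨h1, h2⟩; constructor <;> omega
  · rintro ⟨h1, h2⟩; constructor <;> omega

lemma trT3 (μ : ℝ) : LinearMap.trace ℂ _ (oT3 μ) =
    ∑ t : IdxS μ, if t.1.1 = 0 ∧ t.1.2.1 = 0 then (-Complex.I) ^ t.1.2.2 else 0 := by
  rw [oT3, mono_trace]
  refine Finset.sum_congr rfl fun t _ => ?_
  obtain ⟨⟨m, n, k⟩, h⟩ := t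
  refine if_congr ?_ rfl rfl
  rw [Subtype.ext_iff]
  simp only [eT, Equiv.coe_fn_symm_mk, Prod.ext_iff, and_true, true_and]
  constructor
  · rintro ⟨h1, h2⟩; constructor <;> omega
  · rintro ⟨h1, h2⟩; constructor <;> omega

lemma trX (μ : ℝ) : LinearMap.trace ℂ _ (oX μ) =
    ∑ t : IdxS μ, if t.1.2.1 = 0 ∧ t.1.2.2 = 0 then (-1) ^ t.1.1 else 0 := by
  rw [oX, mono_trace]
  refine Finset.sum_congr rfl fun t _ => ?_
  obtain ⟨⟨m, n, k⟩, h⟩ := t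
  refine if_congr ?_ rfl rfl
  rw [Subtype.ext_iff]
  simp only [eX, Equiv.coe_fn_mk, Prod.ext_iff, and_true, true_and]
  constructor
  · rintro ⟨h1, h2⟩; constructor <;> omega
  · rintro ⟨h1, h2⟩; constructor <;> omega

lemma trY (μ : ℝ) : LinearMap.trace ℂ _ (oY μ) =
    ∑ t : IdxS μ, if t.1.1 = 0 ∧ t.1.2.2 = 0 then (-1) ^ t.1.2.1 else 0 := by
  rw [oY, mono_trace]
  refine Finset.sum_congr rfl fun t _ => ?_
  obtain ⟨⟨m, n, k⟩, h⟩ := t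
  have hi : eY μ ⟨(m, n, k), h⟩ = ⟨(m, n, k), h⟩ ↔ m = 0 ∧ k = 0 := by
    rw [Subtype.ext_iff]
    simp only [eY, Equiv.coe_fn_mk, Prod.ext_iff, and_true, true_and]
    constructor
    · rintro ⟨h1, h2⟩; constructor <;> omega
    · rintro ⟨h1, h2⟩; constructor <;> omega
  simp only [hi]
  split_ifs with h2
  · simp [xY, h2.2]
  · rfl

lemma trZ (μ : ℝ) : LinearMap.trace ℂ _ (oZ μ) =
    ∑ t : IdxS μ, if t.1.1 = 0 ∧ t.1.2.1 = 0 then (-1) ^ t.1.2.2 else 0 := by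
  rw [oZ, mono_trace]
  refine Finset.sum_congr rfl fun t _ => ?_
  obtain ⟨⟨m, n, k⟩, h⟩ := t
  have hi : eZ μ ⟨(m, n, k), h⟩ = ⟨(m, n, k), h⟩ ↔ m = 0 ∧ n = 0 := by
    rw [Subtype.ext_iff]
    simp only [eZ, Equiv.coe_fn_mk, Prod.ext_iff, and_true, true_and]
    constructor
    · rintro ⟨h1, h2⟩; constructor <;> omega
    · rintro ⟨h1, h2⟩; constructor <;> omega
  simp only [hi]
  split_ifs with h2
  · simp [xZ, h2.1, h2.2]
  · rfl

lemma trace_main (μ : ℝ) : LinearMap.trace ℂ _ (oT μ) + LinearMap.trace ℂ _ (oT3 μ) =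
    LinearMap.trace ℂ _ (oX μ) + LinearMap.trace ℂ _ (oY μ) := by
  classical
  rw [trT, trT3, trX, trY, axisY μ (fun m => (-1 : ℂ) ^ m), axisX μ (fun m => (-1 : ℂ) ^ m),
    ← Finset.sum_add_distrib, ← Finset.sum_add_distrib]
  refine Finset.sum_congr rfl fun t _ => ?_
  obtain ⟨⟨m, n, k⟩, h⟩ := t
  by_cases h1 : m = 0 ∧ n = 0
  · rcases Int.even_or_odd k with hk | hk
    · obtain ⟨j, rfl⟩ := hk
      have h3 : (j + j) / 2 = j := by omega
      have h4 := I_even j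
      rw [two_mul] at h4
      simp only [h1, h3, h4, Even.add_self, and_self, if_true]
    · have hk' : ¬ Even k := by simpa using hk
      simp [h1, hk', I_odd k hk]
  · have h2 : ¬ (m = 0 ∧ n = 0 ∧ Even k) := fun h => h1 ⟨h.1, h.2.1⟩
    simp only [h1, h2, if_false]

/-- for every real `μ`, the dimension of the `τ`-invariant part of `E_μ`
(the eigenspace of eigenvalue `4π²μ` on Tetra) equals the dimension of the part of
`E_μ` invariant under both `ρ_x` and `ρ_y` (the eigenspace on Didi): Tetra and Didi
are isospectral. -/
theorem tetra_didi_isospectral (μ : ℝ) :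
    Module.finrank ℂ ↥(Espace μ ⊓ fixT) =
      Module.finrank ℂ ↥(Espace μ ⊓ (fixX ⊓ fixY)) := by
  rw [mapT, mapD, ← ((FT μ).equivMapOfInjective _ (Syn_inj μ)).finrank_eq,
    ← ((FD μ).equivMapOfInjective _ (Syn_inj μ)).finrank_eq]
  have h1 := (projT μ).trace
  have h2 := (projD μ).trace
  have h3 := trace_main μ
  have h4 : LinearMap.trace ℂ _ (oT2 μ) = LinearMap.trace ℂ _ (oZ μ) := by rw [trT2, trZ]
  simp only [map_smul, map_add, smul_eq_mul] at h1 h2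
  have h5 : (Module.finrank ℂ (FT μ) : ℂ) = Module.finrank ℂ (FD μ) := by
    rw [← h1, ← h2]
    linear_combination (4⁻¹ : ℂ) * (h3 + h4)
  exact_mod_cast h5
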